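/- Hoffman's sum formula derived from partial integration at length m: for admissible (k₁,…,k_{m−1}) with k₁ ≥ 2, ζ(k₁,…,k_{m−1},1) plus Σ_{κ=1}^{m−1} Σ_{n_κ=1}^{k_κ} ζ(k₁,…,k_{κ−1}, k_κ+1−n_κ, n_κ, k_{κ+1},…,k_{m−1}) equals Σ_{κ=1}^{m−1} [ ζ(k₁,…,k_{κ−1}, k_κ+1, k_{κ+1},…,k_{m−1}) + ζ(k₁,…,k_κ, 1, k_{κ+1},…,k_{m−1}) ], where in the inner sum only admissible indices (convergent MZVs) appear since the leading entry k₁+1−n₁ ≥ 1 case n₁ = k₁ is excluded when it would produce a leading 1; assume all appearing multiple zeta values are convergent (i.e., leading entries ≥ 2). -/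

import Mathlib

/-- The multiple zeta value `ζ(k₁,…,k_r)` for an index list `k`,
as a sum over strictly decreasing tuples of positive integers. -/
noncomputable def mzv (k : List ℕ) : ℝ :=
  ∑' f : {f : Fin k.length → ℕ // StrictAnti f ∧ ∀ i, 0 < f i},
    ∏ i, 1 / (f.val i : ℝ) ^ (k.get i)

open Finset Filter Topology

/-- weight `1/n^a`, zero at `n = 0` -/
noncomputable def wt (a n : ℕ) : ℝ := if n = 0 then 0 else 1 / (n : ℝ) ^ a

/-- truncated multiple zeta values -/
noncomputable def tz : List ℕ → ℕ → ℝ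
  | [], _ => 1
  | a :: k, N => ∑ n ∈ range N, wt a n * tz k n

lemma wt_nonneg (a n : ℕ) : 0 ≤ wt a n := by
  unfold wt; split_ifs <;> positivity

lemma tz_nonneg (k : List ℕ) (N : ℕ) : 0 ≤ tz k N := by
  induction k generalizing N with
  | nil => simp [tz]
  | cons a k ih => exact Finset.sum_nonneg fun n _ => mul_nonneg (wt_nonneg a n) (ih n)

lemma tz_cons (a : ℕ) (k : List ℕ) (N : ℕ) :
    tz (a :: k) N = ∑ n ∈ range N, wt a n * tz k n := rfl

/-- the harmonic sums -/
noncomputable def hs (N : ℕ) : ℝ := ∑ m ∈ range N, wt 1 m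

lemma stuffle_step (g : ℕ → ℝ) (N : ℕ) :
    hs N * ∑ n ∈ range N, g n
      = (∑ m ∈ range N, wt 1 m * ∑ n ∈ range m, g n) + ∑ n ∈ range N, g n * hs (n + 1) := by
  induction N with
  | zero => simp
  | succ N ih =>
    have h1 : hs (N + 1) = hs N + wt 1 N := by simp [hs, sum_range_succ]
    rw [sum_range_succ, sum_range_succ, sum_range_succ (fun n => g n * hs (n + 1)), h1]
    linear_combination ih

lemma stuffle (k : List ℕ) (N : ℕ) :
    hs N * tz k N = tz (1 :: k) N + ∑ κ : Fin k.length,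
          (tz (k.take κ ++ (k.get κ + 1) :: k.drop (κ + 1)) N
            + tz (k.take (κ + 1) ++ 1 :: k.drop (κ + 1)) N) := by
  induction k generalizing N with
  | nil => simp [tz, hs]
  | cons a k ih =>
    rw [tz_cons a k, stuffle_step, tz_cons 1 (a :: k)]
    congr 1
    have e : ∀ n, wt a n * tz k n * hs (n + 1)
        = wt (a + 1) n * tz k n + (wt a n * tz (1 :: k) n + ∑ κ : Fin k.length,
          (wt a n * tz (k.take κ ++ (k.get κ + 1) :: k.drop (κ + 1)) n
            + wt a n * tz (k.take (κ + 1) ++ 1 :: k.drop (κ + 1)) n)) := by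
      intro n
      have h1 : hs (n + 1) = hs n + wt 1 n := by simp [hs, sum_range_succ]
      have h2 : wt (a + 1) n = wt a n * wt 1 n := by
        unfold wt; split_ifs
        · simp
        · field_simp; ring
      have := ih n
      simp only [← mul_add, ← mul_sum]
      rw [h1, h2]
      linear_combination wt a n * this
    rw [sum_congr rfl fun n _ => e n, sum_add_distrib, sum_add_distrib, sum_comm]
    simp only [List.length_cons, Fin.sum_univ_succ]
    simp [tz_cons, sum_add_distrib]
    ring

lemma partial_frac (a m n : ℕ) (hm : m ≠ 0) (hn : n ≠ 0) :
    wt 1 m * wt a n = (∑ j ∈ Icc 1 a, wt (a + 1 - j) (m + n) * wt j n) + wt a (m + n) * wt 1 m := by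
  have hmn : m + n ≠ 0 := by omega
  have h0 : (m : ℝ) ≠ 0 := by exact_mod_cast hm
  have h1 : (n : ℝ) ≠ 0 := by exact_mod_cast hn
  have h2 : (m : ℝ) + n ≠ 0 := by exact_mod_cast hmn
  induction a with
  | zero => simp [wt, hm, hn]
  | succ a ih =>
    rw [sum_Icc_succ_top (by omega)]
    have e : ∑ j ∈ Icc 1 a, wt (a + 1 + 1 - j) (m + n) * wt j n
        = wt 1 (m + n) * ∑ j ∈ Icc 1 a, wt (a + 1 - j) (m + n) * wt j n := by
      rw [mul_sum]
      refine sum_congr rfl fun j hj => ?_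
      have : a + 1 + 1 - j = (a + 1 - j) + 1 := by have := (mem_Icc.1 hj).2; omega
      rw [this]
      simp only [wt, hmn, hn, if_false]
      push_cast
      field_simp
      try ring
    rw [e, show (∑ j ∈ Icc 1 a, wt (a + 1 - j) (m + n) * wt j n)
      = wt 1 m * wt a n - wt a (m + n) * wt 1 m by rw [ih]; ring]
    simp only [wt, hmn, hm, hn, if_false, show a + 1 + 1 - (a + 1) = 1 by omega]
    push_cast
    field_simp
    ring

lemma shuffle_step (a : ℕ) (f : ℕ → ℝ) (l : ℕ) :
    ∑ m ∈ range (l + 1), wt 1 m * (wt a (l - m) * f (l - m))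
      = (∑ j ∈ Icc 1 a, wt (a + 1 - j) l * ∑ n ∈ range l, wt j n * f n)
        + wt a l * ∑ m ∈ range l, wt 1 m * f (l - m) := by
  rcases Nat.eq_zero_or_pos l with rfl | hl
  · simp [wt]
  have A : ∀ F : ℕ → ℝ, F 0 = 0 → ∑ m ∈ range l, F m = ∑ m ∈ Ico 1 l, F m := by
    intro F hF
    rw [range_eq_Ico, sum_eq_sum_Ico_succ_bot hl, hF, zero_add]
  rw [sum_range_succ, Nat.sub_self, A _ (by simp [wt]), A (fun m => wt 1 m * f (l - m)) (by simp [wt])]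
  have hz : wt a 0 = 0 := by simp [wt]
  rw [hz, zero_mul, mul_zero, add_zero]
  have B : ∀ j, ∑ n ∈ range l, wt j n * f n = ∑ m ∈ Ico 1 l, wt j (l - m) * f (l - m) := by
    intro j
    rw [A _ (by simp [wt])]
    refine sum_nbij' (fun n => l - n) (fun n => l - n) ?_ ?_ ?_ ?_ ?_
    · intro n hn; simp only [mem_Ico] at *; omega
    · intro n hn; simp only [mem_Ico] at *; omega
    · intro n hn; simp only [mem_Ico] at *; omega
    · intro n hn; simp only [mem_Ico] at *; omega
    · intro n hn
      simp only [mem_Ico] at hn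
      rw [show l - (l - n) = n by omega]
  simp only [B, mul_sum]
  rw [sum_comm, ← sum_add_distrib]
  refine sum_congr rfl fun m hm => ?_
  simp only [mem_Ico] at hm
  have := partial_frac a m (l - m) (by omega) (by omega)
  rw [show m + (l - m) = l by omega] at this
  rw [← mul_assoc, this, add_mul, sum_mul]
  simp only [mul_assoc]

lemma shuffle (k : List ℕ) (N : ℕ) :
    ∑ m ∈ range N, wt 1 m * tz k (N - m) = tz (k ++ [1]) N + ∑ κ : Fin k.length,
      ∑ n ∈ Icc 1 (k.get κ), tz (k.take κ ++ (k.get κ + 1 - n) :: n :: k.drop (κ + 1)) N := by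
  induction k generalizing N with
  | nil => simp [tz]
  | cons a k ih =>
    simp only [tz_cons a k, mul_sum]
    rw [← sum_range_diag_flip N (fun m n => wt 1 m * (wt a n * tz k n))]
    rw [sum_congr rfl fun l _ => shuffle_step a (tz k) l]
    simp only [ih, List.length_cons, Fin.sum_univ_succ]
    simp [tz_cons, sum_add_distrib, mul_add, mul_sum]
    rw [sum_comm, sum_comm (s := range N) (t := univ)]
    simp only [sum_comm (s := range N) (t := Icc 1 _)]
    ring

lemma conv_swap (g : ℕ → ℝ) (N : ℕ) :
    ∑ m ∈ range N, wt 1 m * ∑ n ∈ range (N - m), g n = ∑ n ∈ range N, g n * hs (N - n) := by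
  simp only [hs, mul_sum]
  rw [← sum_range_diag_flip N (fun m n => wt 1 m * g n),
    ← sum_range_diag_flip N (fun n m => g n * wt 1 m)]
  refine sum_congr rfl fun l _ => ?_
  rw [← sum_flip]
  refine sum_congr rfl fun m hm => ?_
  have := mem_range.1 hm
  rw [show l - (l - m) = m by omega, mul_comm]

/-! bounds -/

lemma tz_bound (k : List ℕ) (hk : ∀ a ∈ k, 1 ≤ a) (N : ℕ) (hN : 1 ≤ N) :
    tz k N ≤ 3 ^ k.length * √(N : ℝ) := by
  induction k generalizing N with
  | nil => simpa [tz] using hN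
  | cons a k ih =>
    have ih' := ih (fun b hb => hk b (List.mem_cons_of_mem _ hb))
    have ha := hk a List.mem_cons_self
    clear hN
    rw [tz_cons]
    induction N with
    | zero => simp
    | succ n ihn =>
      rw [sum_range_succ]
      rcases Nat.eq_zero_or_pos n with rfl | hn
      · simp [wt]
      have h1 := ih' n hn
      have hn1 : (1 : ℝ) ≤ n := by exact_mod_cast hn
      have hw : wt a n ≤ 1 / n := by
        rw [wt, if_neg (by omega)]
        apply one_div_le_one_div_of_le (by positivity)
        exact le_self_pow₀ hn1 (by omega)
      set s := √(n : ℝ) with hs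
      set t := √((n + 1 : ℕ) : ℝ) with ht
      have hs2 : s ^ 2 = n := Real.sq_sqrt (by positivity)
      have ht2 : t ^ 2 = n + 1 := by rw [ht, Real.sq_sqrt (by positivity)]; push_cast; ring
      have hs1 : 1 ≤ s := by rw [hs]; exact Real.one_le_sqrt.2 hn1
      have ht0 : 0 ≤ t := Real.sqrt_nonneg _
      have h2 : wt a n * tz k n ≤ 1 / n * (3 ^ k.length * s) :=
        mul_le_mul hw h1 (tz_nonneg _ _) (by positivity)
      have h3 : 1 / (n : ℝ) * s ≤ 3 * (t - s) := by
        rw [← hs2]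
        have : 1 / s ^ 2 * s = 1 / s := by field_simp
        rw [this, div_le_iff₀ (by linarith)]
        have htle : t ≤ 2 * s := by nlinarith
        have h4 : (t - s) * (t + s) = 1 := by nlinarith
        have h5 : 0 ≤ t - s := by nlinarith
        nlinarith
      have h6 : 1 / (n : ℝ) * (3 ^ k.length * s) ≤ 3 ^ k.length * (3 * (t - s)) := by
        calc _ = 3 ^ k.length * (1 / (n : ℝ) * s) := by ring
          _ ≤ _ := by gcongr
      simp only [List.length_cons, pow_succ] at ihn ⊢
      linarith

lemma tz_tendsto_aux (a : ℕ) (k : List ℕ) (ha : 2 ≤ a) (hk : ∀ a ∈ k, 1 ≤ a) :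
    Summable fun n => wt a n * tz k n := by
  have hsum : Summable fun n : ℕ => (3 : ℝ) ^ k.length * (1 / (n : ℝ) ^ (3 / 2 : ℝ)) :=
    (Real.summable_one_div_nat_rpow.2 (by norm_num)).mul_left _
  refine Summable.of_nonneg_of_le (fun n => mul_nonneg (wt_nonneg _ _) (tz_nonneg _ _)) ?_ hsum
  intro n
  rcases Nat.eq_zero_or_pos n with rfl | hn
  · simp [wt]
  have hn1 : (1 : ℝ) ≤ n := by exact_mod_cast hn
  have hn0 : (0 : ℝ) < n := by linarith
  have hw : wt a n ≤ 1 / (n : ℝ) ^ 2 := by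
    rw [wt, if_neg (by omega)]
    apply one_div_le_one_div_of_le (by positivity)
    exact pow_le_pow_right₀ hn1 ha
  calc wt a n * tz k n ≤ 1 / (n : ℝ) ^ 2 * (3 ^ k.length * √(n : ℝ)) :=
        mul_le_mul hw (tz_bound k hk n hn) (tz_nonneg _ _) (by positivity)
    _ = _ := by
      have : (n : ℝ) ^ 2 = (n : ℝ) ^ (3 / 2 : ℝ) * √(n : ℝ) := by
        rw [Real.sqrt_eq_rpow, ← Real.rpow_add hn0, ← Real.rpow_natCast]
        norm_num
      rw [this]
      have : √(n : ℝ) ≠ 0 := by positivity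
      field_simp

/-! comparison with `mzv` -/

open Classical in
lemma tz_eq_sum (k : List ℕ) (N : ℕ) :
    ∑ f ∈ (Fintype.piFinset fun _ : Fin k.length => range N).filter
        (fun f => StrictAnti f ∧ ∀ i, 0 < f i),
      ∏ i, 1 / (f i : ℝ) ^ (k.get i) = tz k N := by
  induction k generalizing N with
  | nil =>
    rw [tz, filter_true_of_mem]
    · simp
    · intro f _
      exact ⟨fun i => i.elim0, fun i => i.elim0⟩
  | cons a k ih =>
    rw [tz_cons]
    have : ∑ n ∈ range N, wt a n * tz k n = ∑ n ∈ Ico 1 N, 1 / (n : ℝ) ^ a * tz k n := by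
      rcases Nat.eq_zero_or_pos N with rfl | hN
      · simp
      rw [range_eq_Ico, sum_eq_sum_Ico_succ_bot hN]
      simp only [wt, if_true, zero_mul, zero_add]
      refine sum_congr rfl fun n hn => ?_
      have := (mem_Ico.1 hn).1
      rw [if_neg (by omega)]
    rw [this]
    simp only [← ih, mul_sum]
    rw [sum_sigma']
    symm
    refine sum_bij' (fun p _ => (Fin.cons p.1 p.2 : Fin (k.length + 1) → ℕ))
      (fun f _ => ⟨f (0 : Fin (k.length + 1)), fun i => f (Fin.succ i)⟩) ?_ ?_ ?_ ?_ ?_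
    · rintro ⟨n, f⟩ h
      simp only [mem_sigma, mem_Ico, mem_filter, Fintype.mem_piFinset, mem_range] at h ⊢
      obtain ⟨⟨h1, h2⟩, h3, h4, h5⟩ := h
      refine ⟨?_, ?_, ?_⟩
      · intro i
        refine Fin.cases ?_ (fun j => ?_) i
        · simpa using h2
        · simpa using (h3 j).trans h2
      · intro i j
        refine Fin.cases ?_ (fun i => ?_) i <;> refine Fin.cases ?_ (fun j => ?_) j
        · simp
        · intro _; simpa using h3 j
        · intro h; exact absurd h (Fin.not_lt_zero _)
        · intro h; simpa using h4 (Fin.succ_lt_succ_iff.1 h)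
      · intro i
        refine Fin.cases ?_ (fun j => ?_) i
        · simpa using Nat.lt_of_lt_of_le Nat.zero_lt_one h1
        · simpa using h5 j
    · intro f h
      simp only [mem_sigma, mem_Ico, mem_filter, Fintype.mem_piFinset, mem_range] at h ⊢
      obtain ⟨h3, h4, h5⟩ := h
      exact ⟨⟨h5 _, h3 _⟩, fun i => h4 (Fin.succ_pos i),
        fun i j hij => h4 (Fin.succ_lt_succ_iff.2 hij), fun i => h5 _⟩
    · rintro ⟨n, f⟩ h
      simp
    · intro f h
      funext i
      refine Fin.cases ?_ (fun j => ?_) i <;> simp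
    · rintro ⟨n, f⟩ h
      simp [Fin.prod_univ_succ, mul_comm]

lemma mzv_tendsto (k : List ℕ) (h2 : 2 ≤ k.headI) (hk : ∀ a ∈ k, 1 ≤ a) :
    Tendsto (tz k) atTop (𝓝 (mzv k)) := by
  classical
  obtain ⟨c, hc⟩ : ∃ c, Tendsto (tz k) atTop (𝓝 c) := by
    cases k with
    | nil => simp at h2
    | cons a k =>
      exact ⟨_, (tz_tendsto_aux a k h2 fun b hb =>
        hk b (List.mem_cons_of_mem _ hb)).hasSum.tendsto_sum_nat⟩
  let P : (Fin k.length → ℕ) → Prop := fun f => StrictAnti f ∧ ∀ i, 0 < f i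
  let S : ℕ → Finset {f // P f} := fun N =>
    (Fintype.piFinset fun _ : Fin k.length => range N).subtype P
  let G : {f // P f} → ℝ := fun f => ∏ i, 1 / (f.val i : ℝ) ^ (k.get i)
  have hS : ∀ N, ∑ f ∈ S N, G f = tz k N := by
    intro N
    rw [← tz_eq_sum]
    exact Finset.sum_subtype_eq_sum_filter (p := P)
      (fun f : Fin k.length → ℕ => ∏ i, 1 / (f i : ℝ) ^ (k.get i))
  have hmono : Monotone S := by
    intro M N hMN f
    simp only [S, mem_subtype, Fintype.mem_piFinset, mem_range]
    exact fun h i => (h i).trans_le hMN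
  have hex : ∀ f, ∃ N, f ∈ S N := by
    intro f
    refine ⟨(∑ i, f.val i) + 1, ?_⟩
    simp only [S, mem_subtype, Fintype.mem_piFinset, mem_range]
    intro i
    have := Finset.single_le_sum (f := f.val) (fun _ _ => Nat.zero_le _) (mem_univ i)
    omega
  have hSt : Tendsto S atTop atTop := tendsto_atTop_finset_of_monotone hmono hex
  have hG : ∀ f, 0 ≤ G f := fun f => Finset.prod_nonneg fun i _ => by positivity
  obtain ⟨B, hB⟩ := hc.bddAbove_range
  have hsum : Summable G := by
    refine summable_of_sum_le (c := B) hG fun u => ?_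
    obtain ⟨N, hN⟩ := (hSt.eventually (eventually_ge_atTop u)).exists
    calc ∑ f ∈ u, G f ≤ ∑ f ∈ S N, G f := sum_le_sum_of_subset_of_nonneg hN fun f _ _ => hG f
      _ = tz k N := hS N
      _ ≤ B := hB ⟨N, rfl⟩
  have := hsum.hasSum.comp hSt
  simp only [Function.comp_def, hS] at this
  exact this

/-! the error term -/

lemma hs_diff (n N : ℕ) (h : n < N) : hs N - hs (N - n) = ∑ i ∈ range n, wt 1 (N - n + i) := by
  have := Finset.sum_range_add (wt 1) (N - n) n
  rw [show N - n + n = N by omega] at this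
  rw [hs, hs, this]; ring

lemma wt_one_tendsto : Tendsto (wt 1) atTop (𝓝 0) := by
  refine tendsto_one_div_atTop_nhds_zero_nat.congr' ?_
  filter_upwards [eventually_ne_atTop 0] with n hn
  simp [wt, hn]

lemma error_tendsto (g : ℕ → ℝ) (hg : ∀ n, 0 ≤ g n) (hsum : Summable fun n => g n * hs (n + 1)) :
    Tendsto (fun N => ∑ n ∈ range N, g n * (hs N - hs (N - n))) atTop (𝓝 0) := by
  have key : Tendsto (fun N => ∑' n, if n < N then g n * (hs N - hs (N - n)) else 0) atTop
      (𝓝 (∑' _ : ℕ, (0 : ℝ))) := by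
    refine tendsto_tsum_of_dominated_convergence hsum ?_ ?_
    · intro n
      have h1 : Tendsto (fun N => g n * ∑ i ∈ range n, wt 1 (N - n + i)) atTop (𝓝 0) := by
        have : Tendsto (fun N => g n * ∑ i ∈ range n, wt 1 (N - n + i)) atTop
            (𝓝 (g n * ∑ i ∈ range n, (0 : ℝ))) := by
          refine (tendsto_finsetSum _ fun i _ => wt_one_tendsto.comp ?_).const_mul _
          exact tendsto_atTop_mono (fun N => Nat.le_add_right _ _) (tendsto_sub_atTop_nat n)
        simpa using this
      refine h1.congr' ?_
      filter_upwards [eventually_gt_atTop n] with N hN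
      rw [if_pos hN, hs_diff n N hN]
    · refine Eventually.of_forall fun N n => ?_
      have h0 : 0 ≤ hs (n + 1) := Finset.sum_nonneg fun i _ => wt_nonneg _ _
      split_ifs with h
      · rw [hs_diff n N h, Real.norm_of_nonneg
          (mul_nonneg (hg n) (Finset.sum_nonneg fun i _ => wt_nonneg _ _))]
        refine mul_le_mul_of_nonneg_left ?_ (hg n)
        have : hs (n + 1) = ∑ i ∈ range n, wt 1 (i + 1) := by
          rw [hs, sum_range_succ']; simp [wt]
        rw [this]
        refine sum_le_sum fun i _ => ?_
        rw [wt, wt, if_neg (by omega), if_neg (by omega)]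
        apply one_div_le_one_div_of_le (by positivity)
        have : i + 1 ≤ N - n + i := by omega
        simpa using (by exact_mod_cast this : ((i + 1 : ℕ) : ℝ) ≤ ((N - n + i : ℕ) : ℝ))
      · simpa using mul_nonneg (hg n) h0
  rw [tsum_zero] at key
  refine key.congr fun N => ?_
  rw [tsum_eq_sum (s := range N)]
  · exact sum_congr rfl fun n hn => if_pos (mem_range.1 hn)
  · intro n hn
    exact if_neg (by simpa using hn)

theorem hoffman_sum_formula (k : List ℕ) (hne : k ≠ [])
    (hadm : 2 ≤ k.headI) (hpos : ∀ i : Fin k.length, 1 ≤ k.get i) :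
    mzv (k ++ [1])
      + ∑ κ : Fin k.length,
          ∑ n ∈ (Finset.Icc 1 (k.get κ)).filter (fun n => ¬(κ.val = 0 ∧ n = k.get κ)),
            mzv (k.take κ ++ (k.get κ + 1 - n) :: n :: k.drop (κ + 1))
      = ∑ κ : Fin k.length,
          (mzv (k.take κ ++ (k.get κ + 1) :: k.drop (κ + 1))
            + mzv (k.take (κ + 1) ++ 1 :: k.drop (κ + 1))) := by
  have hk : ∀ a ∈ k, 1 ≤ a := by
    intro a ha
    obtain ⟨i, rfl⟩ := List.mem_iff_get.1 ha
    exact hpos i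
  have hT : ∀ i, ∀ a ∈ k.take i, 1 ≤ a := fun i a ha => hk a (List.mem_of_mem_take ha)
  have hD : ∀ i, ∀ a ∈ k.drop i, 1 ≤ a := fun i a ha => hk a (List.mem_of_mem_drop ha)
  -- limits
  have L1 : Tendsto (tz (k ++ [1])) atTop (𝓝 (mzv (k ++ [1]))) := by
    refine mzv_tendsto _ ?_ ?_
    · cases k with
      | nil => exact absurd rfl hne
      | cons a k => simpa using hadm
    · intro a ha
      rcases List.mem_append.1 ha with h | h
      · exact hk a h
      · simp at h; omega
  have L2 : ∀ κ : Fin k.length,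
      ∀ n ∈ (Finset.Icc 1 (k.get κ)).filter (fun n => ¬(κ.val = 0 ∧ n = k.get κ)),
      Tendsto (tz (k.take κ ++ (k.get κ + 1 - n) :: n :: k.drop (κ + 1))) atTop
        (𝓝 (mzv (k.take κ ++ (k.get κ + 1 - n) :: n :: k.drop (κ + 1)))) := by
    intro κ n hn
    simp only [mem_filter, mem_Icc] at hn
    refine mzv_tendsto _ ?_ ?_
    · rcases κ with ⟨i, hi⟩
      cases k with
      | nil => exact absurd rfl hne
      | cons a k =>
        cases i with
        | zero => simp at hn ⊢; omega
        | succ i => simpa using hadm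
    · intro a ha
      simp only [List.mem_append, List.mem_cons] at ha
      rcases ha with h | h | h | h
      · exact hT _ a h
      · omega
      · omega
      · exact hD _ a h
  have L3 : ∀ κ : Fin k.length,
      Tendsto (tz (k.take κ ++ (k.get κ + 1) :: k.drop (κ + 1))) atTop
        (𝓝 (mzv (k.take κ ++ (k.get κ + 1) :: k.drop (κ + 1)))) := by
    intro κ
    refine mzv_tendsto _ ?_ ?_
    · rcases κ with ⟨i, hi⟩
      cases k with
      | nil => exact absurd rfl hne
      | cons a k =>
        cases i with
        | zero => simp at hadm ⊢; omega
        | succ i => simpa using hadm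
    · intro a ha
      simp only [List.mem_append, List.mem_cons] at ha
      rcases ha with h | h | h
      · exact hT _ a h
      · omega
      · exact hD _ a h
  have L4 : ∀ κ : Fin k.length,
      Tendsto (tz (k.take (κ + 1) ++ 1 :: k.drop (κ + 1))) atTop
        (𝓝 (mzv (k.take (κ + 1) ++ 1 :: k.drop (κ + 1)))) := by
    intro κ
    refine mzv_tendsto _ ?_ ?_
    · cases k with
      | nil => exact absurd rfl hne
      | cons a k => simpa using hadm
    · intro a ha
      simp only [List.mem_append, List.mem_cons] at ha
      rcases ha with h | h | h
      · exact hT _ a h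
      · omega
      · exact hD _ a h
  have LL := L1.add (tendsto_finsetSum univ fun κ _ => tendsto_finsetSum _ (L2 κ))
  have LR := tendsto_finsetSum univ fun κ _ => (L3 κ).add (L4 κ)
  suffices hE : Tendsto (fun N => (∑ κ : Fin k.length,
          (tz (k.take κ ++ (k.get κ + 1) :: k.drop (κ + 1)) N
            + tz (k.take (κ + 1) ++ 1 :: k.drop (κ + 1)) N)) - (tz (k ++ [1]) N
      + ∑ κ : Fin k.length,
          ∑ n ∈ (Finset.Icc 1 (k.get κ)).filter (fun n => ¬(κ.val = 0 ∧ n = k.get κ)),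
            tz (k.take κ ++ (k.get κ + 1 - n) :: n :: k.drop (κ + 1)) N)) atTop (𝓝 0) by
    have := tendsto_nhds_unique hE (LR.sub LL)
    linarith
  clear LL L1 L2 L3 L4
  cases k with
  | nil => exact absurd rfl hne
  | cons a k =>
    have hR : ∀ N, ∑ κ : Fin (a :: k).length,
          (tz ((a :: k).take κ ++ ((a :: k).get κ + 1) :: (a :: k).drop (κ + 1)) N
            + tz ((a :: k).take (κ + 1) ++ 1 :: (a :: k).drop (κ + 1)) N)
          = ∑ n ∈ range N, (wt a n * tz k n) * hs (n + 1) := by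
      intro N
      have h1 := stuffle (a :: k) N
      have h2 := stuffle_step (fun n => wt a n * tz k n) N
      rw [tz_cons 1, tz_cons a] at h1
      simp only [tz_cons a k] at h1
      linarith
    have hg : ∀ n, 0 ≤ wt a n * tz k n := fun n => mul_nonneg (wt_nonneg _ _) (tz_nonneg _ _)
    have hsum : Summable fun n => (wt a n * tz k n) * hs (n + 1) := by
      have h3 := LR.congr hR
      exact ((hasSum_iff_tendsto_nat_of_nonneg (fun n => mul_nonneg (hg n)
        (Finset.sum_nonneg fun i _ => wt_nonneg _ _)) _).2 h3).summable
    refine (error_tendsto _ hg hsum).congr fun N => ?_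
    have h1 := stuffle (a :: k) N
    have h2 := shuffle (a :: k) N
    have h4 : ∑ κ : Fin (a :: k).length, ∑ n ∈ Icc 1 ((a :: k).get κ),
          tz ((a :: k).take κ ++ ((a :: k).get κ + 1 - n) :: n :: (a :: k).drop (κ + 1)) N
        = tz (1 :: a :: k) N + ∑ κ : Fin (a :: k).length,
          ∑ n ∈ (Finset.Icc 1 ((a :: k).get κ)).filter
            (fun n => ¬(κ.val = 0 ∧ n = (a :: k).get κ)),
          tz ((a :: k).take κ ++ ((a :: k).get κ + 1 - n) :: n :: (a :: k).drop (κ + 1)) N := by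
      have ha : 1 ≤ a := hk a List.mem_cons_self
      simp only [List.length_cons, Fin.sum_univ_succ]
      rw [← add_assoc]
      congr 1
      · have : (Icc 1 a).filter (fun n => ¬ (n = a)) = (Icc 1 a).erase a := by
          ext n; simp only [mem_filter, mem_erase]; tauto
        simp [this]
        rw [← Finset.add_sum_erase (Icc 1 a) _ (mem_Icc.2 ⟨ha, le_rfl⟩)]
        simp
      · simp
    have h5 := conv_swap (fun n => wt a n * tz k n) N
    simp only [← tz_cons a k] at h5
    simp only [mul_sub, sum_sub_distrib, ← sum_mul]
    rw [← h5, ← tz_cons a k]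
    linarith
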